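/- arXiv:1401.6387 — 2 statements merged into one kernel-verified Lean document; each statement's English description precedes it below -/
import Mathlib

section
/- Every squared tiling of the 13×13 square that contains a square of side length 10 consists of at least 13 squares, and there exists such a tiling with exactly 13 squares; hence the minimum number of tiles in a squared tiling of the 13×13 square using at least one 10×10 square equals 13. -/
/-- A squared tiling of the `n × n` square: a finite set of triples `(x, y, h)`
representing an `h × h` square with upper-left corner at cell `(x, y)`,
where `1 ≤ h ≤ n - 1`, the square lies inside the board, and every cell
`(i, j)` with `i, j < n` is covered by exactly one square of the tiling. -/
def IsSquaredTiling (n : ℕ) (T : Finset (ℕ × ℕ × ℕ)) : Prop :=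
  (∀ t ∈ T, 1 ≤ t.2.2 ∧ t.2.2 ≤ n - 1 ∧ t.1 + t.2.2 ≤ n ∧ t.2.1 + t.2.2 ≤ n) ∧
  (∀ i j : ℕ, i < n → j < n →
    ∃! t : ℕ × ℕ × ℕ, t ∈ T ∧
      t.1 ≤ i ∧ i < t.1 + t.2.2 ∧ t.2.1 ≤ j ∧ j < t.2.1 + t.2.2)

/-- `s n` is the minimum number of squares in a squared tiling of the
`n × n` square. -/
noncomputable def s (n : ℕ) : ℕ :=
  sInf {k | ∃ T : Finset (ℕ × ℕ × ℕ), IsSquaredTiling n T ∧ T.card = k}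

/-- bit mask of `n` rows of width `h` starting at cell index `p` (row length 13) -/
def rowsMask (h p : ℕ) : ℕ → ℕ
  | 0 => 0
  | n + 1 => rowsMask h p n ||| ((2 ^ h - 1) <<< (p + 13 * n))

/-- attempt to place a square of side `h` at cell `p`; `c` is its slack cost -/
def tryPlace (f : ℕ → ℕ → Bool) (p m s h c : ℕ) : Bool :=
  Nat.ble c s && (Nat.ble (p % 13 + h) 13 && (Nat.ble (p / 13 + h) 13 &&
    (Nat.beq (m &&& rowsMask h p h) 0 && f (m ||| rowsMask h p h) (s - c))))

/-- exhaustive search in row-major order with slack budget `s` -/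
def search : ℕ → ℕ → ℕ → ℕ → Bool
  | 0, _, _, _ => true
  | fuel + 1, p, m, s =>
    bif Nat.beq ((m >>> p) % 2) 1 then search fuel (p + 1) m s
    else tryPlace (search fuel (p + 1)) p m s 3 0 ||
      (tryPlace (search fuel (p + 1)) p m s 2 5 ||
       tryPlace (search fuel (p + 1)) p m s 1 8)

theorem rowsMask_testBit (h p n q : ℕ) :
    (rowsMask h p n).testBit q = true ↔ ∃ i, i < n ∧ p + 13 * i ≤ q ∧ q < p + 13 * i + h := by
  induction n with
  | zero => simp [rowsMask]
  | succ n ih =>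
    rw [rowsMask, Nat.testBit_or, Bool.or_eq_true, ih, Nat.testBit_shiftLeft,
      Nat.testBit_two_pow_sub_one]
    simp only [Bool.and_eq_true, decide_eq_true_eq, ge_iff_le]
    constructor
    · rintro (⟨i, h1, h2, h3⟩ | ⟨h1, h2⟩)
      · exact ⟨i, by omega, h2, h3⟩
      · exact ⟨n, by omega, h1, by omega⟩
    · rintro ⟨i, h1, h2, h3⟩
      by_cases hi : i = n
      · subst hi; right; omega
      · left; exact ⟨i, by omega, h2, h3⟩

/-- cell `(i, j)` is covered by the square `t` -/
def Cov (t : ℕ × ℕ × ℕ) (i j : ℕ) : Prop :=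
  t.1 ≤ i ∧ i < t.1 + t.2.2 ∧ t.2.1 ≤ j ∧ j < t.2.1 + t.2.2

instance (t : ℕ × ℕ × ℕ) (i j : ℕ) : Decidable (Cov t i j) := by
  unfold Cov; infer_instance

theorem rowsMask_cov (x y h i j : ℕ) (hy : y + h ≤ 13) (hj : j < 13) :
    (rowsMask h (13 * x + y) h).testBit (13 * i + j) = true ↔ Cov (x, y, h) i j := by
  rw [rowsMask_testBit]
  unfold Cov
  constructor
  · rintro ⟨r, h1, h2, h3⟩
    simp only
    have : i = x + r := by omega
    omega
  · rintro ⟨h1, h2, h3, h4⟩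
    simp only at h1 h2 h3 h4
    exact ⟨i - x, by omega, by omega, by omega⟩

/-- slack of a square of side at most 3 -/
def wt (t : ℕ × ℕ × ℕ) : ℕ := 9 - t.2.2 ^ 2

theorem search_sound (T : Finset (ℕ × ℕ × ℕ)) (hT : IsSquaredTiling 13 T) :
    ∀ (fuel p m s : ℕ) (R : Finset (ℕ × ℕ × ℕ)), p + fuel = 169 → R ⊆ T →
      (∀ t ∈ R, t.2.2 ≤ 3) → (∑ t ∈ R, wt t) ≤ s →
      (∀ i j, i < 13 → j < 13 →
        (m.testBit (13 * i + j) = true ↔ ∃ t ∈ T, t ∉ R ∧ Cov t i j)) →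
      (∀ q, q < p → m.testBit q = true) → search fuel p m s = true := by
  intro fuel
  induction fuel with
  | zero => intros; rfl
  | succ fuel ih =>
    intro p m s R hp hR h3 hs hm hq
    have hbit : Nat.beq ((m >>> p) % 2) 1 = m.testBit p := by
      rw [Nat.testBit_eq_decide_div_mod_eq, Nat.shiftRight_eq_div_pow]
      rw [Bool.eq_iff_iff]; simp
    rw [search, hbit]
    cases hb : m.testBit p with
    | true =>
      simp only [cond_true]
      refine ih (p + 1) m s R (by omega) hR h3 hs hm ?_
      intro q hq'
      by_cases h : q = p
      · subst h; exact hb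
      · exact hq q (by omega)
    | false =>
      simp only [cond_false]
      obtain ⟨i, j, hi, hj, rfl⟩ : ∃ i j, i < 13 ∧ j < 13 ∧ p = 13 * i + j :=
        ⟨p / 13, p % 13, by omega, by omega, by omega⟩
      obtain ⟨⟨x, y, h⟩, ⟨htT, htc⟩, -⟩ := hT.2 i j hi hj
      change Cov (x, y, h) i j at htc
      have uniq : ∀ a b, a < 13 → b < 13 → ∀ t ∈ T, ∀ t' ∈ T, Cov t a b → Cov t' a b → t = t' :=
        fun a b ha hb' t ht t' ht' c c' => (hT.2 a b ha hb').unique ⟨ht, c⟩ ⟨ht', c'⟩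
      have htR : (x, y, h) ∈ R := by
        by_contra hn
        have := (hm i j hi hj).2 ⟨_, htT, hn, htc⟩
        rw [hb] at this; exact absurd this (by simp)
      obtain ⟨b1, b2, b3, b4⟩ := hT.1 _ htT
      have h3' := h3 _ htR
      simp only at b1 b2 b3 b4 h3'
      have hcorner : ¬ (13 * x + y < 13 * i + j) := by
        intro hlt
        obtain ⟨t, ht, htn, htc'⟩ := (hm x y (by omega) (by omega)).1 (hq _ hlt)
        have := uniq x y (by omega) (by omega) t ht _ htT htc' ⟨le_refl _, by simp only; omega, le_refl _, by simp only; omega⟩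
        rw [this] at htn
        exact htn htR
      have hxy : x = i ∧ y = j := by
        obtain ⟨c1, c2, c3, c4⟩ := htc
        simp only at c1 c2 c3 c4
        omega
      obtain ⟨rfl, rfl⟩ := hxy
      have hsum := Finset.add_sum_erase R wt htR
      have key : tryPlace (search fuel (13 * x + y + 1)) (13 * x + y) m s h (wt (x, y, h)) = true := by
        unfold tryPlace
        simp only [Bool.and_eq_true, Nat.ble_eq, Nat.beq_eq]
        refine ⟨by omega, by omega, by omega, ?_, ?_⟩
        · apply Nat.eq_of_testBit_eq
          intro q
          rw [Nat.testBit_and, Nat.zero_testBit, Bool.and_eq_false_iff]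
          by_contra hcon
          push Not at hcon
          simp only [ne_eq, Bool.not_eq_false] at hcon
          obtain ⟨g1, g2⟩ := hcon
          have hq13 : q / 13 < 13 := by
            obtain ⟨r, r1, r2, r3⟩ := (rowsMask_testBit _ _ _ _).1 g2
            omega
          have hqe : q = 13 * (q / 13) + q % 13 := by omega
          rw [hqe] at g1 g2
          rw [rowsMask_cov _ _ _ _ _ b4 (by omega)] at g2
          obtain ⟨t, ht, htn, htc'⟩ := (hm _ _ hq13 (by omega)).1 g1
          have := uniq _ _ hq13 (by omega) t ht _ htT htc' g2
          rw [this] at htn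
          exact htn htR
        · refine ih _ _ _ (R.erase (x, y, h)) (by omega) ((Finset.erase_subset _ _).trans hR)
            (fun t ht => h3 t (Finset.mem_of_mem_erase ht)) (by omega) ?_ ?_
          · intro a b ha hb'
            rw [Nat.testBit_or, Bool.or_eq_true, hm a b ha hb', rowsMask_cov _ _ _ _ _ b4 hb']
            constructor
            · rintro (⟨t, ht, htn, c⟩ | c)
              · exact ⟨t, ht, fun hh => htn (Finset.mem_of_mem_erase hh), c⟩
              · exact ⟨_, htT, Finset.notMem_erase _ _, c⟩
            · rintro ⟨t, ht, htn, c⟩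
              by_cases he : t = (x, y, h)
              · subst he; exact Or.inr c
              · exact Or.inl ⟨t, ht, fun hh => htn (Finset.mem_erase.2 ⟨he, hh⟩), c⟩
          · intro q hq'
            rw [Nat.testBit_or, Bool.or_eq_true]
            by_cases he : q = 13 * x + y
            · right; rw [he, rowsMask_cov _ _ _ _ _ b4 (by omega)]; exact htc
            · left; exact hq q (by omega)
      have hh : h = 3 ∨ h = 2 ∨ h = 1 := by omega
      rcases hh with rfl | rfl | rfl
      · simp only [wt] at key; norm_num at key; rw [key]; rfl
      · simp only [wt] at key; norm_num at key; rw [key]; simp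
      · simp only [wt] at key; norm_num at key; rw [key]; simp

theorem area (T : Finset (ℕ × ℕ × ℕ)) (hT : IsSquaredTiling 13 T) :
    ∑ t ∈ T, t.2.2 ^ 2 = 169 := by
  have h1 : T.biUnion (fun t => Finset.Ico t.1 (t.1 + t.2.2) ×ˢ Finset.Ico t.2.1 (t.2.1 + t.2.2))
      = Finset.range 13 ×ˢ Finset.range 13 := by
    ext ⟨i, j⟩
    simp only [Finset.mem_biUnion, Finset.mem_product, Finset.mem_Ico, Finset.mem_range]
    constructor
    · rintro ⟨t, ht, h⟩
      have := hT.1 t ht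
      omega
    · rintro ⟨hi, hj⟩
      obtain ⟨t, ⟨ht, h⟩, -⟩ := hT.2 i j hi hj
      exact ⟨t, ht, by omega⟩
  have h2 := congrArg Finset.card h1
  rw [Finset.card_biUnion] at h2
  · simp only [Finset.card_product, Nat.card_Ico, Finset.card_range, add_tsub_cancel_left] at h2
    simp only [pow_two]
    omega
  · intro t ht t' ht' hne
    simp only [Function.onFun]
    rw [Finset.disjoint_left]
    rintro ⟨i, j⟩ ha hb
    simp only [Finset.mem_product, Finset.mem_Ico] at ha hb
    have := hT.1 t ht
    exact hne ((hT.2 i j (by omega) (by omega)).unique ⟨ht, by omega⟩ ⟨ht', by omega⟩)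

theorem search_all : ∀ x < 4, ∀ y < 4,
    search 169 0 (rowsMask 10 (13 * x + y) 10) 30 = false := by
  decide +kernel

theorem lower (T : Finset (ℕ × ℕ × ℕ)) (hT : IsSquaredTiling 13 T)
    (hex : ∃ t ∈ T, t.2.2 = 10) : 13 ≤ T.card := by
  obtain ⟨⟨x, y, h⟩, ht, h10⟩ := hex
  simp only at h10
  subst h10
  by_contra hlt
  obtain ⟨-, -, b3, b4⟩ := hT.1 _ ht
  simp only at b3 b4
  have h3 : ∀ t ∈ T.erase (x, y, 10), t.2.2 ≤ 3 := by
    intro t ht'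
    obtain ⟨hne, htT⟩ := Finset.mem_erase.1 ht'
    have := hT.1 t htT
    by_contra hc
    refine hne ((hT.2 (max x t.1) (max y t.2.1) (by omega) (by omega)).unique
      ⟨htT, by omega⟩ ⟨ht, ?_⟩)
    simp only
    omega
  have hA := area T hT
  rw [← Finset.add_sum_erase T _ ht] at hA
  simp only at hA
  have hsum : ∑ t ∈ T.erase (x, y, 10), wt t + ∑ t ∈ T.erase (x, y, 10), t.2.2 ^ 2
      = 9 * (T.erase (x, y, 10)).card := by
    rw [← Finset.sum_add_distrib, Finset.sum_const_nat (m := 9), mul_comm]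
    intro t ht'
    have := h3 t ht'
    unfold wt
    have : t.2.2 ^ 2 ≤ 9 := by nlinarith
    omega
  have hcard := Finset.card_erase_of_mem ht
  have hs := search_sound T hT 169 0 (rowsMask 10 (13 * x + y) 10) 30 (T.erase (x, y, 10)) rfl
    (Finset.erase_subset _ _) h3 (by omega) ?_ (by intro q hq; omega)
  · rw [search_all x (by omega) y (by omega)] at hs
    exact absurd hs (by simp)
  · intro i j hi hj
    rw [rowsMask_cov _ _ _ _ _ b4 hj]
    constructor
    · intro c; exact ⟨_, ht, Finset.notMem_erase _ _, c⟩
    · rintro ⟨t, htT, htn, c⟩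
      by_cases he : t = (x, y, 10)
      · subst he; exact c
      · exact absurd (Finset.mem_erase.2 ⟨he, htT⟩) htn

/-- an explicit tiling with 13 squares -/
def exT : Finset (ℕ × ℕ × ℕ) :=
  {(0, 0, 10), (0, 10, 3), (3, 10, 3), (6, 10, 3), (10, 0, 3), (10, 3, 3), (10, 6, 3),
   (9, 10, 1), (10, 9, 2), (12, 9, 1), (12, 10, 1), (9, 11, 2), (11, 11, 2)}

theorem exT_tiling : IsSquaredTiling 13 exT := by
  constructor
  · decide
  · have h : ∀ i < 13, ∀ j < 13, ∃ t ∈ exT, Cov t i j ∧ ∀ t' ∈ exT, Cov t' i j → t' = t := by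
      decide +kernel
    intro i j hi hj
    obtain ⟨t, ht, hc, hu⟩ := h i hi j hj
    exact ⟨t, ⟨ht, hc⟩, fun t' h' => hu t' h'.1 h'.2⟩

theorem min_tiles_13_with_10 :
    (∀ T : Finset (ℕ × ℕ × ℕ), IsSquaredTiling 13 T →
      (∃ t ∈ T, t.2.2 = 10) → 13 ≤ T.card) ∧
    (∃ T : Finset (ℕ × ℕ × ℕ), IsSquaredTiling 13 T ∧
      (∃ t ∈ T, t.2.2 = 10) ∧ T.card = 13) :=
  ⟨lower, exT, exT_tiling, by decide, by decide⟩
end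

section
/- s(19) = 13: the minimum number of squares in a squared tiling of the 19×19 square by strictly smaller integer squares equals 13. -/
inductive Sk where
  | nil : Sk
  | cons (w h : Nat) (t : Sk) : Sk

noncomputable def force (x : Nat) (f : Nat → Bool) : Bool :=
  Nat.rec (motive := fun _ => Bool) false (fun p _ => f p) (Nat.add x (nat_lit 1))

noncomputable def lbgt (s : Sk) : Nat → Nat → Bool :=
  Sk.rec (motive := fun _ => Nat → Nat → Bool) (fun _ _ => false)
    (fun w h _ ih mask k =>
      force (Nat.shiftRight mask h) fun m =>
      force (Nat.shiftLeft (Nat.lor m (nat_lit 1)) h) fun mask' =>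
      Nat.rec (motive := fun _ => Bool)
        (Bool.rec (motive := fun _ => Bool)
          (force (Nat.div (Nat.sub (Nat.add w (nat_lit 18)) h) (Nat.sub (nat_lit 19) h)) fun n =>
            Bool.rec (motive := fun _ => Bool) true
              (force (Nat.sub k n) (fun k' => ih mask' k')) (Nat.ble n k))
          (Nat.rec (motive := fun _ => Bool) true (fun k' _ => ih mask' k') k)
          (Nat.ble (Nat.add w h) (nat_lit 19)))
        (fun _ _ => ih mask' k)
        (Nat.land m (nat_lit 1))) s

noncomputable def normK (s : Sk) : (Sk → Bool) → Bool :=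
  Sk.rec (motive := fun _ => (Sk → Bool) → Bool) (fun K => K Sk.nil)
    (fun w h _ ih K => ih fun t' =>
      Sk.rec (motive := fun _ => Bool) (K (Sk.cons w h Sk.nil))
        (fun w2 h2 t2 _ =>
          Bool.rec (motive := fun _ => Bool) (K (Sk.cons w h (Sk.cons w2 h2 t2)))
            (force (Nat.add w w2) fun w3 => K (Sk.cons w3 h t2)) (Nat.beq h h2)) t') s

noncomputable def minK (s : Sk) : Nat → (Nat → Bool) → Bool :=
  Sk.rec (motive := fun _ => Nat → (Nat → Bool) → Bool) (fun m K => K m)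
    (fun _ h _ ih m K => Bool.rec (motive := fun _ => Bool) (ih h K) (ih m K) (Nat.ble m h)) s

noncomputable def widK (s : Sk) (h : Nat) : Nat → (Nat → Nat → Bool) → Bool :=
  Sk.rec (motive := fun _ => Nat → (Nat → Nat → Bool) → Bool) (fun _ _ => false)
    (fun w h' t ih c K => Bool.rec (motive := fun _ => Bool)
      (force (Nat.add c w) fun c' => ih c' K)
      (Sk.rec (motive := fun _ => Bool) (K c w)
        (fun _ h2 _ _ => Bool.rec (motive := fun _ => Bool) (K c w) false (Nat.beq h2 h)) t)
      (Nat.beq h' h)) s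

noncomputable def childK (s : Sk) (h q : Nat) : (Sk → Bool) → Bool :=
  Sk.rec (motive := fun _ => (Sk → Bool) → Bool) (fun K => K Sk.nil)
    (fun w h' t ih K => Bool.rec (motive := fun _ => Bool)
      (ih fun t' => K (Sk.cons w h' t'))
      (force (Nat.add h q) fun hq =>
        Bool.rec (motive := fun _ => Bool)
          (force (Nat.sub w q) fun wq => K (Sk.cons q hq (Sk.cons wq h t)))
          (K (Sk.cons q hq t)) (Nat.beq w q))
      (Nat.beq h' h)) s

noncomputable def loop (s : Sk) (h : Nat) (f : Nat → Sk → Bool) (n : Nat) : Bool :=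
  Nat.rec (motive := fun _ => Bool) true
    (fun q' r => force (Nat.add q' (nat_lit 1)) fun q =>
      Bool.rec (motive := fun _ => Bool) false r (childK s h q (f q))) n

noncomputable def expand (s : Sk) (f : Nat → Nat → Nat → Sk → Bool) : Bool :=
  minK s (nat_lit 19) fun h =>
    Bool.rec (motive := fun _ => Bool)
      (widK s h (nat_lit 0) fun c w =>
        force (Nat.sub (nat_lit 19) h) fun d =>
        loop s h (f c h) (Bool.rec (motive := fun _ => Nat) d w (Nat.ble w d)))
      false (Nat.ble (nat_lit 19) h)

/-- the square `(c,h,q)` does not touch the bottom, but touches another side -/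
noncomputable def onBd (c h q : Nat) : Bool :=
  Bool.rec (motive := fun _ => Bool)
    (Bool.rec (motive := fun _ => Bool)
      (Bool.rec (motive := fun _ => Bool)
        (Nat.beq (Nat.add h q) (nat_lit 19)) true (Nat.beq (Nat.add c q) (nat_lit 19)))
      true (Nat.beq c (nat_lit 0)))
    false (Nat.beq h (nat_lit 0))

noncomputable def refute (bd : Bool) (k : Nat) : Sk → Bool :=
  Nat.rec (motive := fun _ => Sk → Bool) (fun s => lbgt s (nat_lit 0) (nat_lit 0))
    (fun k' ih s => normK s fun s => Bool.rec (motive := fun _ => Bool)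
      (expand s fun c h q s' => Bool.rec (motive := fun _ => Bool) (ih s')
        (Bool.rec (motive := fun _ => Bool) true (ih s') (onBd c h q)) bd) true
      (lbgt s (nat_lit 0) (Nat.succ k'))) k

noncomputable def bottom (a : Nat) (m : Nat) : Nat → Sk → Bool :=
  Nat.rec (motive := fun _ => Nat → Sk → Bool)
    (fun k s => refute true k s)
    (fun _ ih k s => Nat.rec (motive := fun _ => Bool) false
      (fun k' _ => normK s fun s => Bool.rec (motive := fun _ => Bool) (expand s fun c h q s' =>
        Bool.rec (motive := fun _ => Bool) (refute false k' s')
          (Bool.rec (motive := fun _ => Bool) (ih k' s')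
            (Bool.rec (motive := fun _ => Bool) true (ih k' s') (Nat.ble q a))
            (Nat.beq (Nat.add c q) (nat_lit 19)))
          (Nat.beq h (nat_lit 0))) true (lbgt s (nat_lit 0) (Nat.succ k'))) k) m

theorem force_eq (x : Nat) (f : Nat → Bool) : force x f = f x := rfl

def hgt : Sk → ℕ → ℕ
  | .nil, _ => 19
  | .cons w h t, i => if i < w then h else hgt t (i - w)

def tot : Sk → ℕ
  | .nil => 0
  | .cons w _ t => w + tot t

def Pos : Sk → Prop
  | .nil => True
  | .cons w _ t => 1 ≤ w ∧ Pos t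

theorem hgt_cons_ge {w h : ℕ} {t : Sk} {i : ℕ} (hi : w ≤ i) : hgt (.cons w h t) i = hgt t (i - w) := by
  simp [hgt, hi]

theorem hgt_cons_lt {w h : ℕ} {t : Sk} {i : ℕ} (hi : i < w) : hgt (.cons w h t) i = h := by
  simp [hgt, hi]

theorem hgt_cons_add {w h : ℕ} {t : Sk} {i : ℕ} : hgt (.cons w h t) (w + i) = hgt t i := by
  simp [hgt]

theorem normK_spec (s : Sk) : ∀ K : Sk → Bool, normK s K = true →
    ∃ s', K s' = true ∧ (∀ i, hgt s' i = hgt s i) ∧ tot s' = tot s ∧ (Pos s → Pos s') := by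
  induction s with
  | nil => exact fun K hK => ⟨.nil, hK, fun _ => rfl, rfl, id⟩
  | cons w h t ih =>
    intro K hK
    obtain ⟨t', h1, h2, h3, h4⟩ := ih _ hK
    cases t' with
    | nil =>
      refine ⟨_, h1, ?_, ?_, ?_⟩
      · intro i; simp only [hgt, ← h2]
      · simp only [tot, ← h3]
      · exact fun p => ⟨p.1, trivial⟩
    | cons w2 hh2 t2 =>
      cases hb : Nat.beq h hh2 with
      | false =>
        simp only [hb] at h1
        refine ⟨_, h1, ?_, ?_, ?_⟩
        · intro i; simp only [hgt, ← h2]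
        · simp only [tot, ← h3]
        · exact fun p => ⟨p.1, h4 p.2⟩
      | true =>
        simp only [hb, force_eq] at h1
        have he := Nat.eq_of_beq_eq_true hb
        subst he
        refine ⟨_, h1, ?_, ?_, ?_⟩
        · intro i
          simp only [hgt, ← h2, Nat.add_eq]
          split_ifs <;> first | rfl | omega | (congr 1; omega)
        · simp only [tot, ← h3, Nat.add_eq]; omega
        · intro p
          have := h4 p.2
          exact ⟨by have := p.1; simp only [Nat.add_eq]; omega, this.2⟩

theorem minK_spec (s : Sk) : ∀ (m : ℕ) (K : ℕ → Bool), m ≤ 19 → minK s m K = true →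
    ∃ h, K h = true ∧ h ≤ m ∧ ∀ i, h ≤ hgt s i := by
  induction s with
  | nil => exact fun m K hm hK => ⟨m, hK, le_rfl, fun _ => hm⟩
  | cons w h t ih =>
    intro m K hm hK
    change Bool.rec (motive := fun _ => Bool) (minK t h K) (minK t m K) (Nat.ble m h) = true at hK
    cases hb : Nat.ble m h with
    | false =>
      rw [hb] at hK
      have : ¬ m ≤ h := by intro hh; rw [Nat.ble_eq_true_of_le hh] at hb; cases hb
      obtain ⟨h', a, b, c⟩ := ih h K (by omega) hK
      refine ⟨h', a, by omega, fun i => ?_⟩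
      simp only [hgt]; split_ifs
      · exact b
      · exact c _
    | true =>
      rw [hb] at hK
      have := Nat.le_of_ble_eq_true hb
      obtain ⟨h', a, b, c⟩ := ih m K hm hK
      refine ⟨h', a, by omega, fun i => ?_⟩
      simp only [hgt]; split_ifs
      · omega
      · exact c _

theorem loop_spec (s : Sk) (h : ℕ) (f : ℕ → Sk → Bool) (n : ℕ) (H : loop s h f n = true) :
    ∀ q, 1 ≤ q → q ≤ n → childK s h q (f q) = true := by
  induction n with
  | zero => intro q h1 h2; omega
  | succ n ih =>
    intro q h1 h2
    change Bool.rec (motive := fun _ => Bool) false (loop s h f n) (childK s h (n+1) (f (n+1))) = true at H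
    cases hc : childK s h (n+1) (f (n+1)) with
    | false => rw [hc] at H; cases H
    | true =>
      rw [hc] at H
      rcases Nat.lt_or_ge n q with h3 | h3
      · have : q = n + 1 := by omega
        rw [this]; exact hc
      · exact ih H q h1 h3

theorem widK_spec (h : ℕ) (hh : h < 19) (s : Sk) : ∀ (c0 : ℕ) (K : ℕ → ℕ → Bool), Pos s →
    widK s h c0 K = true →
    ∃ c w, K (c0 + c) w = true ∧ c + w ≤ tot s ∧ 1 ≤ w ∧ (∀ i, i < c → hgt s i ≠ h) ∧
      (∀ i, c ≤ i → i < c + w → hgt s i = h) ∧ hgt s (c + w) ≠ h ∧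
      ∀ q (K' : Sk → Bool), 1 ≤ q → q ≤ w → childK s h q K' = true →
        ∃ s', K' s' = true ∧ Pos s' ∧ tot s' = tot s ∧
          ∀ i, hgt s' i = if c ≤ i ∧ i < c + q then h + q else hgt s i := by
  induction s with
  | nil => intro c0 K _ H; cases H
  | cons w h' t ih =>
    intro c0 K hp H
    obtain ⟨hp1, hp2⟩ := hp
    cases hb : Nat.beq h' h with
    | false =>
      change Bool.rec (motive := fun _ => Bool) (widK t h (c0 + w) K) _ (Nat.beq h' h) = true at H
      rw [hb] at H
      have hne : h' ≠ h := by intro e; rw [e, Nat.beq_refl] at hb; cases hb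
      obtain ⟨c, v, a1, a2, a3, a4, a5, a6, a7⟩ := ih _ K hp2 H
      refine ⟨w + c, v, by rwa [← Nat.add_assoc], by simp only [tot]; omega, a3, ?_, ?_, ?_, ?_⟩
      · intro i hi
        simp only [hgt]; split_ifs
        · exact hne
        · exact a4 _ (by omega)
      · intro i h1 h2
        rw [hgt_cons_ge (by omega)]; exact a5 _ (by omega) (by omega)
      · rw [Nat.add_assoc, hgt_cons_add]; exact a6
      · intro q K' q1 q2 hc
        change Bool.rec (motive := fun _ => Bool) (childK t h q fun t' => K' (.cons w h' t')) _ (Nat.beq h' h) = true at hc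
        rw [hb] at hc
        obtain ⟨s', b1, b2, b3, b4⟩ := a7 q _ q1 q2 hc
        refine ⟨_, b1, ⟨hp1, b2⟩, by simp only [tot, b3], fun i => ?_⟩
        simp only [hgt, b4]
        split_ifs <;> first | rfl | omega
    | true =>
      have he := Nat.eq_of_beq_eq_true hb
      subst he
      have hk : K c0 w = true ∧ hgt t 0 ≠ h' := by
        change Bool.rec (motive := fun _ => Bool) _ (Sk.rec (motive := fun _ => Bool) (K c0 w)
          (fun _ h2 _ _ => Bool.rec (motive := fun _ => Bool) (K c0 w) false (Nat.beq h2 h')) t) (Nat.beq h' h') = true at H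
        rw [hb] at H
        cases t with
        | nil => exact ⟨H, by simp only [hgt]; omega⟩
        | cons w2 h2 t2 =>
          change Bool.rec (motive := fun _ => Bool) (K c0 w) false (Nat.beq h2 h') = true at H
          cases hb2 : Nat.beq h2 h' with
          | true => rw [hb2] at H; cases H
          | false =>
            rw [hb2] at H
            refine ⟨H, ?_⟩
            rw [hgt_cons_lt (by exact hp2.1)]
            intro e; rw [e, Nat.beq_refl] at hb2; cases hb2
      refine ⟨0, w, hk.1, by simp [tot], hp1, by simp, ?_, ?_, ?_⟩
      · intro i _ h2; exact hgt_cons_lt (by omega)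
      · have := @hgt_cons_add w h' t 0
        simp only [Nat.add_zero] at this
        rw [Nat.zero_add, this]; exact hk.2
      · intro q K' q1 q2 hc
        change Bool.rec (motive := fun _ => Bool) _ (Bool.rec (motive := fun _ => Bool)
          (K' (Sk.cons q (h' + q) (Sk.cons (w - q) h' t)))
          (K' (Sk.cons q (h' + q) t)) (Nat.beq w q)) (Nat.beq h' h') = true at hc
        rw [hb] at hc
        cases hb2 : Nat.beq w q with
        | true =>
          rw [hb2] at hc
          have := Nat.eq_of_beq_eq_true hb2
          subst this
          refine ⟨_, hc, ⟨q1, hp2⟩, rfl, fun i => ?_⟩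
          simp only [hgt]
          split_ifs <;> first | rfl | omega
        | false =>
          rw [hb2] at hc
          have hne : w ≠ q := by intro e; rw [e, Nat.beq_refl] at hb2; cases hb2
          refine ⟨_, hc, ⟨q1, by omega, hp2⟩, by simp only [tot]; omega, fun i => ?_⟩
          simp only [hgt]
          split_ifs <;> first | rfl | omega | (congr 1; omega)

structure Fill (H : ℕ → ℕ) (R : Finset (ℕ × ℕ × ℕ)) : Prop where
  box : ∀ t ∈ R, 1 ≤ t.2.2 ∧ t.1 + t.2.2 ≤ 19 ∧ t.2.1 + t.2.2 ≤ 19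
  above : ∀ t ∈ R, ∀ i, t.1 ≤ i → i < t.1 + t.2.2 → H i ≤ t.2.1
  cov : ∀ i j, i < 19 → j < 19 → H i ≤ j → ∃ t ∈ R, Cov t i j
  uniq : ∀ t ∈ R, ∀ u ∈ R, ∀ i j, Cov t i j → Cov u i j → t = u

theorem Fill.congr {H H' : ℕ → ℕ} {R} (hF : Fill H R) (e : ∀ i, H' i = H i) : Fill H' R := by
  have : H' = H := funext e
  rwa [this]

theorem Fill.step {H : ℕ → ℕ} {R} (hF : Fill H R) {c h w : ℕ} (hc : c < 19) (hh : h < 19)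
    (hw : 1 ≤ w) (hl : ∀ i, i + 1 = c → h < H i) (hm : ∀ i, c ≤ i → i < c + w → H i = h)
    (hr : h < H (c + w)) :
    ∃ q, 1 ≤ q ∧ q ≤ w ∧ q ≤ 19 - h ∧ (c, h, q) ∈ R ∧
      ∀ H' : ℕ → ℕ, (∀ i, H' i = if c ≤ i ∧ i < c + q then h + q else H i) →
        Fill H' (R.erase (c, h, q)) := by
  have hHc : H c = h := hm c le_rfl (by omega)
  obtain ⟨⟨x, y, q⟩, ht, a1, a2, a3, a4⟩ := hF.cov c h hc hh hHc.le
  simp only at a1 a2 a3 a4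
  have hab := hF.above _ ht
  obtain ⟨b1, b2, b3⟩ := hF.box _ ht
  simp only at hab b1 b2 b3
  have hy : y = h := by have := hab c a1 a2; omega
  subst hy
  have hx : x = c := by
    by_contra hne
    have h1 := hl (c - 1) (by omega)
    have h2 := hab (c - 1) (by omega) (by omega)
    omega
  subst hx
  have hqw : q ≤ w := by
    by_contra hne
    have := hab (x + w) (by omega) (by omega)
    omega
  refine ⟨q, b1, hqw, by omega, ht, fun H' hH' => ⟨?_, ?_, ?_, ?_⟩⟩
  · exact fun t h => hF.box t (Finset.mem_of_mem_erase h)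
  · intro t h i i1 i2
    have htR := Finset.mem_of_mem_erase h
    have hne := Finset.ne_of_mem_erase h
    have hi := hF.above t htR i i1 i2
    rw [hH']
    split_ifs with hc'
    · by_contra hlt
      apply hne
      refine hF.uniq _ htR _ ht i t.2.1 ⟨i1, i2, le_rfl, ?_⟩ ⟨hc'.1, hc'.2, ?_, ?_⟩
      · have := (hF.box t htR).1; omega
      · have := hm i hc'.1 (by omega); simp only; omega
      · simp only; omega
    · exact hi
  · intro i j hi hj hij
    rw [hH'] at hij
    have hHi : H i ≤ j := by
      split_ifs at hij with hc'
      · have := hm i hc'.1 (by omega); omega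
      · exact hij
    obtain ⟨t, htR, htc⟩ := hF.cov i j hi hj hHi
    refine ⟨t, Finset.mem_erase.2 ⟨?_, htR⟩, htc⟩
    rintro rfl
    obtain ⟨d1, d2, d3, d4⟩ := htc
    simp only at d1 d2 d3 d4
    rw [if_pos ⟨d1, d2⟩] at hij
    omega
  · intro t h u h' i j
    exact hF.uniq t (Finset.mem_of_mem_erase h) u (Finset.mem_of_mem_erase h') i j

theorem expand_spec (s : Sk) (f : ℕ → ℕ → ℕ → Sk → Bool) (H : expand s f = true)
    (hp : Pos s) (ht : tot s ≤ 19) {R} (hF : Fill (hgt s) R) :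
    ∃ c h q s', f c h q s' = true ∧ Pos s' ∧ tot s' ≤ 19 ∧ (c, h, q) ∈ R ∧
      Fill (hgt s') (R.erase (c, h, q)) := by
  obtain ⟨h, H1, h19, hmin⟩ := minK_spec s 19 _ le_rfl H
  cases hb : Nat.ble 19 h with
  | true => rw [hb] at H1; cases H1
  | false =>
    rw [hb] at H1
    have hh : h < 19 := by
      by_contra hge
      rw [Nat.ble_eq_true_of_le (by omega)] at hb; cases hb
    obtain ⟨c, w, a1, a2, a3, a4, a5, a6, a7⟩ := widK_spec h hh s 0 _ hp H1
    obtain ⟨q, q1, q2, q3, q4, q5⟩ := hF.step (c := c) (h := h) (w := w) (by omega) hh a3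
      (fun i hi => lt_of_le_of_ne (hmin i) (Ne.symm (a4 i (by omega)))) a5
      (lt_of_le_of_ne (hmin _) (Ne.symm a6))
    rw [Nat.zero_add] at a1
    have hl : childK s h q (f c h q) = true := by
      refine loop_spec s h (f c h) _ a1 q q1 ?_
      cases Nat.ble w (Nat.sub 19 h)
      · exact q3
      · exact q2
    obtain ⟨s', b1, b2, b3, b4⟩ := a7 q _ q1 q2 hl
    exact ⟨c, h, q, s', b1, b2, by omega, q4, q5 _ b4⟩

theorem lbgt_spec (H : ℕ → ℕ) (R : Finset (ℕ × ℕ × ℕ)) (hF : Fill H R) (s : Sk) :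
    ∀ (x mask k : ℕ) (A : Finset (ℕ × ℕ × ℕ)), Pos s → x + tot s ≤ 19 →
      (∀ i, i < tot s → H (x + i) = hgt s i) → A ⊆ R →
      (∀ t ∈ A, t.1 < x ∧ (Nat.testBit mask t.2.1 = true ∨
        ∃ j, t.1 ≤ j ∧ j < x ∧ t.2.1 < H j)) →
      lbgt s mask k = true → A.card + k < R.card := by
  induction s with
  | nil => intro x mask k A _ _ _ _ _ h; cases h
  | cons w h t ih =>
    intro x mask k A hp hx hH hA hI hl
    obtain ⟨hp1, hp2⟩ := hp
    simp only [tot] at hx hH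
    have hH2 : ∀ i, i < tot t → H (x + w + i) = hgt t i := by
      intro i hi
      have := hH (w + i) (by omega)
      rw [hgt_cons_add] at this
      rw [← this, Nat.add_assoc]
    have hHx : ∀ i, i < w → H (x + i) = h := by
      intro i hi
      rw [hH i (by omega), hgt_cons_lt hi]
    set mask' := ((mask >>> h) ||| 1) <<< h with hmask
    have hbit : ∀ b, Nat.testBit mask' b = true ↔ (h ≤ b ∧ (Nat.testBit mask b = true ∨ b = h)) := by
      intro b
      rw [hmask, Nat.testBit_shiftLeft, Nat.testBit_or, Nat.testBit_shiftRight]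
      by_cases hb : h ≤ b
      · have e1 : h + (b - h) = b := by omega
        have e2 : (Nat.testBit 1 (b - h) = true) ↔ b = h := by
          rw [Nat.testBit_one_eq_true_iff_self_eq_zero]; omega
        simp [hb, e1, e2]
      · simp [hb]
    -- transfer of the invariant for old squares
    have hold : ∀ t ∈ A, t.1 < x + w ∧ (Nat.testBit mask' t.2.1 = true ∨
        ∃ j, t.1 ≤ j ∧ j < x + w ∧ t.2.1 < H j) := by
      intro t ht
      obtain ⟨h1, h2⟩ := hI t ht
      refine ⟨by omega, ?_⟩
      rcases h2 with h2 | ⟨j, j1, j2, j3⟩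
      · by_cases hb : h ≤ t.2.1
        · exact Or.inl ((hbit _).2 ⟨hb, Or.inl h2⟩)
        · refine Or.inr ⟨x, by omega, by omega, ?_⟩
          have := hHx 0 (by omega)
          simp only [Nat.add_zero] at this
          omega
      · exact Or.inr ⟨j, j1, by omega, j3⟩
    -- adding n witnesses
    have key : ∀ n k', Nat.testBit mask h = false → (n = 0 ∨ (h < 19 ∧ (n - 1) * (19 - h) < w)) →
        A.card + n ≤ R.card ∧ (lbgt t mask' k' = true → A.card + n + k' < R.card) := by
      intro n k' hnb hn
      have hex : ∀ r, ∃ u : ℕ × ℕ × ℕ, r < n → u ∈ R ∧ u.2.1 = h ∧ u.1 ≤ x + r * (19 - h) ∧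
          x + r * (19 - h) < u.1 + u.2.2 := by
        intro r
        by_cases hr : r < n
        · obtain hn | ⟨h19, hn⟩ := hn
          · omega
          have hrw : r * (19 - h) < w :=
            lt_of_le_of_lt (Nat.mul_le_mul_right _ (by omega)) hn
          have hHr := hHx _ hrw
          obtain ⟨u, hu, c1, c2, c3, c4⟩ := hF.cov (x + r * (19 - h)) h (by omega) h19 hHr.le
          have := hF.above u hu _ c1 c2
          exact ⟨u, fun _ => ⟨hu, by omega, c1, c2⟩⟩
        · exact ⟨(0, 0, 0), fun hh => absurd hh hr⟩
      choose u hu using hex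
      have hlt : ∀ r r', r < n → r' < n → r < r' → u r ≠ u r' := by
        intro r r' hr hr' hrr e
        obtain ⟨a1, a2, a3, a4⟩ := hu r hr
        obtain ⟨b1, b2, b3, b4⟩ := hu r' hr'
        rw [← e] at b3 b4
        have hb := (hF.box _ a1).2.2
        have : (r + 1) * (19 - h) ≤ r' * (19 - h) := Nat.mul_le_mul_right _ hrr
        rw [Nat.add_mul] at this
        omega
      have hinj : Set.InjOn u (Finset.range n : Set ℕ) := by
        intro r hr r' hr' e
        simp only [Finset.coe_range, Set.mem_Iio] at hr hr'
        rcases Nat.lt_trichotomy r r' with hh | hh | hh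
        · exact absurd e (hlt _ _ hr hr' hh)
        · exact hh
        · exact absurd e.symm (hlt _ _ hr' hr hh)
      have hdis : Disjoint A ((Finset.range n).image u) := by
        rw [Finset.disjoint_left]
        intro v hv hv'
        obtain ⟨r, hr, rfl⟩ := Finset.mem_image.1 hv'
        obtain ⟨a1, a2, a3, a4⟩ := hu r (Finset.mem_range.1 hr)
        obtain ⟨b1, b2⟩ := hI _ hv
        rw [a2] at b2
        rcases b2 with b2 | ⟨j, j1, j2, j3⟩
        · rw [hnb] at b2; cases b2
        · have := hF.above _ a1 j j1 (by omega)
          omega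
      have hcard : (A ∪ (Finset.range n).image u).card = A.card + n := by
        rw [Finset.card_union_of_disjoint hdis, Finset.card_image_of_injOn hinj, Finset.card_range]
      rw [← hcard]
      have hsub : A ∪ (Finset.range n).image u ⊆ R := by
        refine Finset.union_subset hA ?_
        intro v hv
        obtain ⟨r, hr, rfl⟩ := Finset.mem_image.1 hv
        exact (hu r (Finset.mem_range.1 hr)).1
      refine ⟨Finset.card_le_card hsub, fun hl' => ?_⟩
      refine ih (x + w) mask' k' _ hp2 (by omega) hH2 hsub ?_ hl'
      · intro v hv
        rcases Finset.mem_union.1 hv with hv | hv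
        · exact hold v hv
        · obtain ⟨r, hr, rfl⟩ := Finset.mem_image.1 hv
          have hr := Finset.mem_range.1 hr
          obtain ⟨a1, a2, a3, a4⟩ := hu r hr
          refine ⟨?_, Or.inl ?_⟩
          · obtain hn | ⟨h19, hn⟩ := hn
            · omega
            have hrw : r * (19 - h) < w :=
              lt_of_le_of_lt (Nat.mul_le_mul_right _ (by omega)) hn
            omega
          · rw [a2]; exact (hbit h).2 ⟨le_rfl, Or.inr rfl⟩
    change Nat.rec (motive := fun _ => Bool)
        (Bool.rec (motive := fun _ => Bool)
          (Bool.rec (motive := fun _ => Bool) true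
              (lbgt t mask' (k - (w + 18 - h) / (19 - h))) (Nat.ble ((w + 18 - h) / (19 - h)) k))
          (Nat.rec (motive := fun _ => Bool) true (fun k' _ => lbgt t mask' k') k)
          (Nat.ble (w + h) 19))
        (fun _ _ => lbgt t mask' k)
        (Nat.land (mask >>> h) 1) = true at hl
    have hland : Nat.land (mask >>> h) 1 = if Nat.testBit mask h then 1 else 0 := by
      change (mask >>> h) &&& 1 = _
      rw [Nat.and_one_is_mod]
      have := Nat.testBit_shiftRight (i := h) (j := 0) mask
      rw [Nat.testBit_zero, Nat.add_zero] at this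
      rw [← this]
      rcases Nat.mod_two_eq_zero_or_one (mask >>> h) with e | e <;> simp [e]
    rw [hland] at hl
    -- a full set of witnesses that overflows the budget
    have ovr : ∀ n, Nat.testBit mask h = false → (n = 0 ∨ (h < 19 ∧ (n - 1) * (19 - h) < w)) →
        k < n → A.card + k < R.card := by
      intro n h1 h2 h3
      have := (key n 0 h1 h2).1
      omega
    cases htb : Nat.testBit mask h with
    | true =>
      rw [htb] at hl
      exact ih (x + w) mask' k A hp2 (by omega) hH2 hA hold hl
    | false =>
      rw [htb] at hl
      change (Bool.rec (motive := fun _ => Bool)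
          (Bool.rec (motive := fun _ => Bool) true
              (lbgt t mask' (k - (w + 18 - h) / (19 - h))) (Nat.ble ((w + 18 - h) / (19 - h)) k))
          (Nat.rec (motive := fun _ => Bool) true (fun k' _ => lbgt t mask' k') k)
          (Nat.ble (w + h) 19)) = true at hl
      cases hb : Nat.ble (w + h) 19 with
      | true =>
        have hle := Nat.le_of_ble_eq_true hb
        rw [hb] at hl
        cases k with
        | zero => exact ovr 1 htb (Or.inr ⟨by omega, by omega⟩) (by omega)
        | succ k' =>
          have := (key 1 k' htb (Or.inr ⟨by omega, by omega⟩)).2 hl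
          omega
      | false =>
        rw [hb] at hl
        set n := (w + 18 - h) / (19 - h) with hn
        have hn' : n = 0 ∨ (h < 19 ∧ (n - 1) * (19 - h) < w) := by
          by_cases h19 : h < 19
          · right
            refine ⟨h19, ?_⟩
            have h1 : n * (19 - h) ≤ w + 18 - h := Nat.div_mul_le_self _ _
            rw [Nat.sub_mul]
            omega
          · left
            rw [hn, show 19 - h = 0 by omega, Nat.div_zero]
        cases hb2 : Nat.ble n k with
        | false =>
          refine ovr n htb hn' ?_
          by_contra hge
          rw [Nat.ble_eq_true_of_le (by omega)] at hb2; cases hb2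
        | true =>
          have hle := Nat.le_of_ble_eq_true hb2
          change (Bool.rec (motive := fun _ => Bool) true
              (lbgt t mask' (k - n)) (Nat.ble n k)) = true at hl
          rw [hb2] at hl
          have := (key n (k - n) htb hn').2 hl
          omega

theorem beq_false_ne {a b : ℕ} (h : Nat.beq a b = false) : a ≠ b := by
  rintro rfl; rw [Nat.beq_refl] at h; cases h

theorem beq_true_eq {a b : ℕ} (h : Nat.beq a b = true) : a = b := Nat.eq_of_beq_eq_true h

theorem lbgt_zero {s : Sk} {k : ℕ} {R} (hl : lbgt s 0 k = true) (hp : Pos s) (ht : tot s ≤ 19)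
    (hF : Fill (hgt s) R) : k < R.card := by
  have := lbgt_spec (hgt s) R hF s 0 0 k ∅ hp (by omega) (fun i _ => by rw [Nat.zero_add])
    (Finset.empty_subset _) (fun t ht => absurd ht (Finset.notMem_empty _)) hl
  simpa using this

def OnB (t : ℕ × ℕ × ℕ) : Prop := t.1 = 0 ∨ t.1 + t.2.2 = 19 ∨ t.2.1 + t.2.2 = 19

theorem onBd_of {c h q : ℕ} (h0 : h ≠ 0) (hb : OnB (c, h, q)) : onBd c h q = true := by
  unfold onBd
  cases e0 : Nat.beq h 0 with
  | true => exact absurd (beq_true_eq e0) h0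
  | false =>
    cases e1 : Nat.beq c 0 with
    | true => rfl
    | false =>
      cases e2 : Nat.beq (c + q) 19 with
      | true => rfl
      | false =>
        change Nat.beq (h + q) 19 = true
        rcases hb with hb | hb | hb
        · exact absurd hb (beq_false_ne e1)
        · exact absurd hb (beq_false_ne e2)
        · simp only at hb; rw [hb]; rfl

theorem refute_sound (bd : Bool) (k : ℕ) : ∀ (s : Sk) (R : Finset (ℕ × ℕ × ℕ)),
    refute bd k s = true → Pos s → tot s ≤ 19 → Fill (hgt s) R → R.card ≤ k →
    (bd = true → ∀ t ∈ R, t.2.1 ≠ 0 ∧ OnB t) → False := by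
  induction k with
  | zero =>
    intro s R h hp ht hF hk _
    have := lbgt_zero (k := 0) h hp ht hF
    omega
  | succ k ih =>
    intro s R h hp ht hF hk hb
    obtain ⟨s1, h1, h2, h3, h4⟩ := normK_spec s _ h
    have hp1 := h4 hp
    have ht1 : tot s1 ≤ 19 := h3 ▸ ht
    have hF1 := hF.congr h2
    clear h h2 h3 h4 hp ht hF
    cases hl : lbgt s1 0 (k + 1) with
    | true =>
      have := lbgt_zero hl hp1 ht1 hF1
      omega
    | false =>
      have h1' : (Bool.rec (motive := fun _ => Bool)
        (expand s1 fun c h q s' => Bool.rec (motive := fun _ => Bool) (refute bd k s')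
        (Bool.rec (motive := fun _ => Bool) true (refute bd k s') (onBd c h q)) bd) true
        (lbgt s1 0 (k + 1))) = true := h1
      rw [hl] at h1'
      obtain ⟨c, hh, q, s', e1, e2, e3, e4, e5⟩ := expand_spec s1 _ h1' hp1 ht1 hF1
      have hc : (R.erase (c, hh, q)).card ≤ k := by
        rw [Finset.card_erase_of_mem e4]; omega
      refine ih s' _ ?_ e2 e3 e5 hc (fun hbd t ht => hb hbd t (Finset.mem_of_mem_erase ht))
      cases bd with
      | false => exact e1
      | true =>
        obtain ⟨b1, b2⟩ := hb rfl _ e4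
        have e1' : (Bool.rec (motive := fun _ => Bool) true (refute true k s') (onBd c hh q)) = true := e1
        rw [onBd_of b1 b2] at e1'
        exact e1'

theorem bottom_sound (a m : ℕ) : ∀ (k : ℕ) (s : Sk) (R : Finset (ℕ × ℕ × ℕ)),
    bottom a m k s = true → Pos s → tot s ≤ 19 → Fill (hgt s) R → R.card ≤ k →
    (R.filter (fun t => t.2.1 = 0)).card ≤ m →
    ((R.filter (fun t => t.2.1 = 0)).card = m → ∀ t ∈ R, t.2.1 = 0 ∨ OnB t) →
    (∀ t ∈ R, t.2.1 = 0 → t.1 + t.2.2 = 19 → t.2.2 ≤ a) → False := by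
  induction m with
  | zero =>
    intro k s R h hp ht hF hk hm hb _
    have h0 : (R.filter (fun t => t.2.1 = 0)).card = 0 := by omega
    refine refute_sound true k s R h hp ht hF hk (fun _ t ht => ?_)
    have hne : t.2.1 ≠ 0 := by
      intro e
      rw [Finset.card_eq_zero] at h0
      have : t ∈ R.filter (fun t => t.2.1 = 0) := Finset.mem_filter.2 ⟨ht, e⟩
      rw [h0] at this
      exact absurd this (Finset.notMem_empty _)
    exact ⟨hne, (hb h0 t ht).resolve_left hne⟩
  | succ m ih =>
    intro k s R h hp ht hF hk hm hb ha
    cases k with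
    | zero => cases h
    | succ k =>
    obtain ⟨s1, h1, h2, h3, h4⟩ := normK_spec s _ h
    have hp1 := h4 hp
    have ht1 : tot s1 ≤ 19 := h3 ▸ ht
    have hF1 := hF.congr h2
    clear h h2 h3 h4 hp ht hF
    cases hl : lbgt s1 0 (k + 1) with
    | true =>
      have := lbgt_zero hl hp1 ht1 hF1
      omega
    | false =>
      have h1' : (Bool.rec (motive := fun _ => Bool) (expand s1 fun c h q s' =>
        Bool.rec (motive := fun _ => Bool) (refute false k s')
          (Bool.rec (motive := fun _ => Bool) (bottom a m k s')
            (Bool.rec (motive := fun _ => Bool) true (bottom a m k s') (Nat.ble q a))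
            (Nat.beq (c + q) 19))
          (Nat.beq h 0)) true (lbgt s1 0 (k + 1))) = true := h1
      rw [hl] at h1'
      obtain ⟨c, hh, q, s', e1, e2, e3, e4, e5⟩ := expand_spec s1 _ h1' hp1 ht1 hF1
      have hc : (R.erase (c, hh, q)).card ≤ k := by
        rw [Finset.card_erase_of_mem e4]; omega
      cases hz : Nat.beq hh 0 with
      | false =>
        simp only [hz] at e1
        exact refute_sound false k s' _ e1 e2 e3 e5 hc (fun hx => by cases hx)
      | true =>
        have hz' : hh = 0 := beq_true_eq hz
        simp only [hz] at e1
        have hfe : ((R.erase (c, hh, q)).filter (fun t => t.2.1 = 0)).card + 1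
            = (R.filter (fun t => t.2.1 = 0)).card := by
          rw [Finset.filter_erase]
          exact Finset.card_erase_add_one (Finset.mem_filter.2 ⟨e4, hz'⟩)
        refine ih k s' _ ?_ e2 e3 e5 hc (by omega)
          (fun hx t ht => hb (by omega) t (Finset.mem_of_mem_erase ht))
          (fun t ht => ha t (Finset.mem_of_mem_erase ht))
        cases hz2 : Nat.beq (c + q) 19 with
        | false => simp only [hz2] at e1; exact e1
        | true =>
          have hqa := ha _ e4 hz' (beq_true_eq hz2)
          simp only [hz2, Nat.ble_eq_true_of_le hqa] at e1
          exact e1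
theorem t1 : bottom 1 3 11 (Sk.cons 1 1 (Sk.cons (19-1) 0 Sk.nil)) = true := by decide +kernel
theorem t2 : bottom 2 3 11 (Sk.cons 2 2 (Sk.cons (19-2) 0 Sk.nil)) = true := by decide +kernel
theorem t3 : bottom 3 3 11 (Sk.cons 3 3 (Sk.cons (19-3) 0 Sk.nil)) = true := by decide +kernel
theorem t4 : bottom 4 3 11 (Sk.cons 4 4 (Sk.cons (19-4) 0 Sk.nil)) = true := by decide +kernel
theorem t5 : bottom 5 3 11 (Sk.cons 5 5 (Sk.cons (19-5) 0 Sk.nil)) = true := by decide +kernel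
theorem t6 : bottom 6 3 11 (Sk.cons 6 6 (Sk.cons (19-6) 0 Sk.nil)) = true := by decide +kernel
theorem t7 : bottom 7 3 11 (Sk.cons 7 7 (Sk.cons (19-7) 0 Sk.nil)) = true := by decide +kernel
theorem t8 : bottom 8 3 11 (Sk.cons 8 8 (Sk.cons (19-8) 0 Sk.nil)) = true := by decide +kernel
theorem t9 : bottom 9 3 11 (Sk.cons 9 9 (Sk.cons (19-9) 0 Sk.nil)) = true := by decide +kernel
theorem t10 : bottom 10 3 11 (Sk.cons 10 10 (Sk.cons (19-10) 0 Sk.nil)) = true := by decide +kernel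
theorem t11 : bottom 11 3 11 (Sk.cons 11 11 (Sk.cons (19-11) 0 Sk.nil)) = true := by decide +kernel
theorem t12 : bottom 12 3 11 (Sk.cons 12 12 (Sk.cons (19-12) 0 Sk.nil)) = true := by decide +kernel
theorem t13 : bottom 13 3 11 (Sk.cons 13 13 (Sk.cons (19-13) 0 Sk.nil)) = true := by decide +kernel
theorem t14 : bottom 14 3 11 (Sk.cons 14 14 (Sk.cons (19-14) 0 Sk.nil)) = true := by decide +kernel
theorem t15 : bottom 15 3 11 (Sk.cons 15 15 (Sk.cons (19-15) 0 Sk.nil)) = true := by decide +kernel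
theorem t16 : bottom 16 3 11 (Sk.cons 16 16 (Sk.cons (19-16) 0 Sk.nil)) = true := by decide +kernel
theorem t17 : bottom 17 3 11 (Sk.cons 17 17 (Sk.cons (19-17) 0 Sk.nil)) = true := by decide +kernel
theorem t18 : bottom 18 3 11 (Sk.cons 18 18 (Sk.cons (19-18) 0 Sk.nil)) = true := by decide +kernel

abbrev Til (T : Finset (ℕ × ℕ × ℕ)) : Prop := IsSquaredTiling 19 T

theorem Til.uniq {T} (hT : Til T) {t u : ℕ × ℕ × ℕ} (ht : t ∈ T) (hu : u ∈ T) {i j : ℕ}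
    (h1 : Cov t i j) (h2 : Cov u i j) : t = u := by
  have hb := hT.1 t ht
  have hi : i < 19 := by have := h1.2.1; omega
  have hj : j < 19 := by have := h1.2.2.2; omega
  exact (hT.2 i j hi hj).unique ⟨ht, h1⟩ ⟨hu, h2⟩

theorem Til.fill {T} (hT : Til T) : Fill (hgt (.cons 19 0 .nil)) T where
  box := fun t ht => ⟨(hT.1 t ht).1, (hT.1 t ht).2.2⟩
  above := by
    intro t ht i h1 h2
    have := hT.1 t ht
    rw [hgt_cons_lt (by omega)]
    omega
  cov := by
    intro i j hi hj _
    obtain ⟨t, ⟨h1, h2⟩, _⟩ := hT.2 i j hi hj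
    exact ⟨t, h1, h2⟩
  uniq := fun t ht u hu i j h1 h2 => hT.uniq ht hu h1 h2

theorem til_image {T} (hT : Til T) (f : ℕ × ℕ × ℕ → ℕ × ℕ × ℕ) (g : ℕ → ℕ → ℕ × ℕ)
    (hb : ∀ t ∈ T, 1 ≤ (f t).2.2 ∧ (f t).2.2 ≤ 19 - 1 ∧ (f t).1 + (f t).2.2 ≤ 19 ∧
      (f t).2.1 + (f t).2.2 ≤ 19)
    (hg : ∀ i j, i < 19 → j < 19 → (g i j).1 < 19 ∧ (g i j).2 < 19)
    (hc : ∀ t ∈ T, ∀ i j, i < 19 → j < 19 → (Cov (f t) i j ↔ Cov t (g i j).1 (g i j).2)) :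
    Til (T.image f) := by
  refine ⟨?_, ?_⟩
  · intro t ht
    obtain ⟨u, hu, rfl⟩ := Finset.mem_image.1 ht
    exact hb u hu
  · intro i j hi hj
    obtain ⟨t, ⟨h1, h2⟩, h3⟩ := hT.2 _ _ (hg i j hi hj).1 (hg i j hi hj).2
    refine ⟨f t, ⟨Finset.mem_image_of_mem f h1, (hc t h1 i j hi hj).2 h2⟩, ?_⟩
    rintro v ⟨hv, hv2⟩
    obtain ⟨u, hu, rfl⟩ := Finset.mem_image.1 hv
    rw [h3 u ⟨hu, (hc u hu i j hi hj).1 hv2⟩]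

def tr (t : ℕ × ℕ × ℕ) : ℕ × ℕ × ℕ := (t.2.1, t.1, t.2.2)
def fl (t : ℕ × ℕ × ℕ) : ℕ × ℕ × ℕ := (19 - t.1 - t.2.2, t.2.1, t.2.2)

theorem tr_inj (T : Finset (ℕ × ℕ × ℕ)) : Set.InjOn tr (T : Set (ℕ × ℕ × ℕ)) := by
  rintro ⟨a, b, c⟩ _ ⟨a', b', c'⟩ _ h
  simp only [tr, Prod.mk.injEq] at h ⊢
  omega

theorem fl_inj {T} (hT : Til T) : Set.InjOn fl (T : Set (ℕ × ℕ × ℕ)) := by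
  rintro ⟨a, b, c⟩ h1 ⟨a', b', c'⟩ h2 h
  have h1 := hT.1 _ h1
  have h2 := hT.1 _ h2
  simp only [fl, Prod.mk.injEq] at h h1 h2 ⊢
  omega

theorem til_tr {T} (hT : Til T) : Til (T.image tr) := by
  refine til_image hT tr (fun i j => (j, i)) ?_ ?_ ?_
  · intro t ht; have := hT.1 t ht; simp only [tr]; omega
  · intro i j hi hj; exact ⟨hj, hi⟩
  · intro t ht i j hi hj; simp only [tr, Cov]; omega

theorem til_fl {T} (hT : Til T) : Til (T.image fl) := by
  refine til_image hT fl (fun i j => (18 - i, j)) ?_ ?_ ?_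
  · intro t ht; have := hT.1 t ht; simp only [fl]; omega
  · intro i j hi hj; exact ⟨by omega, hj⟩
  · intro t ht i j hi hj; have := hT.1 t ht; simp only [fl, Cov]; omega

theorem card_fi {T : Finset (ℕ × ℕ × ℕ)} {f : ℕ × ℕ × ℕ → ℕ × ℕ × ℕ}
    (hf : Set.InjOn f (T : Set (ℕ × ℕ × ℕ))) (p q : ℕ × ℕ × ℕ → Prop)
    [DecidablePred p] [DecidablePred q] (h : ∀ t ∈ T, (p (f t) ↔ q t)) :
    ((T.image f).filter p).card = (T.filter q).card := by
  rw [Finset.filter_image, Finset.card_image_of_injOn (hf.mono (by intro x hx; exact (Finset.mem_filter.1 hx).1))]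
  congr 1
  exact Finset.filter_congr h

def nB (T : Finset (ℕ × ℕ × ℕ)) : ℕ := (T.filter (fun t => t.2.1 = 0)).card
def nL (T : Finset (ℕ × ℕ × ℕ)) : ℕ := (T.filter (fun t => t.1 = 0)).card
def nR (T : Finset (ℕ × ℕ × ℕ)) : ℕ := (T.filter (fun t => t.1 + t.2.2 = 19)).card
def nT (T : Finset (ℕ × ℕ × ℕ)) : ℕ := (T.filter (fun t => t.2.1 + t.2.2 = 19)).card

theorem nB_tr (T) : nB (T.image tr) = nL T := card_fi (tr_inj T) _ _ (fun _ _ => Iff.rfl)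
theorem nR_tr (T) : nR (T.image tr) = nT T := card_fi (tr_inj T) _ _ (fun _ _ => Iff.rfl)
theorem nB_fl {T} (hT : Til T) : nB (T.image fl) = nB T :=
  card_fi (fl_inj hT) _ _ (fun _ _ => Iff.rfl)
theorem nL_fl {T} (hT : Til T) : nL (T.image fl) = nR T :=
  card_fi (fl_inj hT) _ _ (fun t ht => by have := hT.1 t ht; simp only [fl]; omega)

theorem corner {T} (hT : Til T) (p : ℕ × ℕ × ℕ → Prop) [DecidablePred p] (i j : ℕ)
    (h : ∀ t ∈ T, p t → Cov t i j) : (T.filter p).card ≤ 1 := by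
  rw [Finset.card_le_one]
  intro a ha b hb
  rw [Finset.mem_filter] at ha hb
  exact hT.uniq ha.1 hb.1 (h a ha.1 ha.2) (h b hb.1 hb.2)

theorem count {T} (hT : Til T) : nB T + nL T + nR T + nT T +
    (T.filter (fun t => t.2.1 ≠ 0 ∧ t.1 ≠ 0 ∧ t.1 + t.2.2 ≠ 19 ∧ t.2.1 + t.2.2 ≠ 19)).card
      ≤ T.card + 4 := by
  have c1 := corner hT (fun t => t.1 = 0 ∧ t.2.1 = 0) 0 0 (by
    intro t ht h; have := hT.1 t ht; simp only [Cov]; omega)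
  have c2 := corner hT (fun t => t.1 + t.2.2 = 19 ∧ t.2.1 = 0) 18 0 (by
    intro t ht h; have := hT.1 t ht; simp only [Cov]; omega)
  have c3 := corner hT (fun t => t.1 = 0 ∧ t.2.1 + t.2.2 = 19) 0 18 (by
    intro t ht h; have := hT.1 t ht; simp only [Cov]; omega)
  have c4 := corner hT (fun t => t.1 + t.2.2 = 19 ∧ t.2.1 + t.2.2 = 19) 18 18 (by
    intro t ht h; have := hT.1 t ht; simp only [Cov]; omega)
  have key : nB T + nL T + nR T + nT T +
    (T.filter (fun t => t.2.1 ≠ 0 ∧ t.1 ≠ 0 ∧ t.1 + t.2.2 ≠ 19 ∧ t.2.1 + t.2.2 ≠ 19)).card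
      ≤ T.card + (T.filter (fun t => t.1 = 0 ∧ t.2.1 = 0)).card +
      (T.filter (fun t => t.1 + t.2.2 = 19 ∧ t.2.1 = 0)).card +
      (T.filter (fun t => t.1 = 0 ∧ t.2.1 + t.2.2 = 19)).card +
      (T.filter (fun t => t.1 + t.2.2 = 19 ∧ t.2.1 + t.2.2 = 19)).card := by
    rw [Finset.card_eq_sum_ones T]
    simp only [nB, nL, nR, nT, Finset.card_filter, ← Finset.sum_add_distrib]
    refine Finset.sum_le_sum fun t ht => ?_
    have := hT.1 t ht
    split_ifs <;> omega
  omega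

def Bal (T : Finset (ℕ × ℕ × ℕ)) : Prop :=
  ∀ t ∈ T, ∀ u ∈ T, t.1 = 0 → t.2.1 = 0 → u.2.1 = 0 → u.1 + u.2.2 = 19 → u.2.2 ≤ t.2.2

theorem bal_or {T} (hT : Til T) : Bal T ∨ Bal (T.image fl) := by
  by_contra hcon
  rw [not_or] at hcon
  obtain ⟨h1, h2⟩ := hcon
  simp only [Bal, not_forall] at h1 h2
  obtain ⟨t, ht, u, hu, a1, a2, a3, a4, a5⟩ := h1
  obtain ⟨t', ht', u', hu', b1, b2, b3, b4, b5⟩ := h2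
  obtain ⟨v, hv, rfl⟩ := Finset.mem_image.1 ht'
  obtain ⟨w, hw, rfl⟩ := Finset.mem_image.1 hu'
  have k1 := hT.1 t ht
  have k2 := hT.1 u hu
  have k3 := hT.1 v hv
  have k4 := hT.1 w hw
  simp only [fl] at b1 b2 b3 b4 b5
  have e1 : t = w := hT.uniq ht hw (i := 0) (j := 0) (by simp only [Cov]; omega)
    (by simp only [Cov]; omega)
  have e2 : u = v := hT.uniq hu hv (i := 18) (j := 0) (by simp only [Cov]; omega)
    (by simp only [Cov]; omega)
  subst e1 e2
  omega

theorem core {T} (hT : Til T) (hc : T.card ≤ 12)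
    (hmin : ∀ T', Til T' → T'.card ≤ 12 → nB T ≤ nB T') (hbal : Bal T) : False := by
  have htr := til_tr hT
  have hfl := til_fl hT
  have ctr : (T.image tr).card = T.card := Finset.card_image_of_injOn (tr_inj T)
  have cfl : (T.image fl).card = T.card := Finset.card_image_of_injOn (fl_inj hT)
  have m1 : nB T ≤ nL T := by
    rw [← nB_tr]; exact hmin _ htr (by omega)
  have m2 : nB T ≤ nR T := by
    rw [← nL_fl hT, ← nB_tr]
    refine hmin _ (til_tr hfl) ?_
    rw [Finset.card_image_of_injOn (tr_inj _)]; omega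
  have m3 : nB T ≤ nT T := by
    rw [← nR_tr, ← nL_fl htr, ← nB_tr]
    refine hmin _ (til_tr (til_fl htr)) ?_
    rw [Finset.card_image_of_injOn (tr_inj _), Finset.card_image_of_injOn (fl_inj htr)]; omega
  have hcount := count hT
  have hB4 : nB T ≤ 4 := by omega
  have hbd : nB T = 4 → ∀ t ∈ T, t.2.1 = 0 ∨ OnB t := by
    intro h4 t ht
    have h0 : (T.filter (fun t => t.2.1 ≠ 0 ∧ t.1 ≠ 0 ∧ t.1 + t.2.2 ≠ 19 ∧
        t.2.1 + t.2.2 ≠ 19)).card = 0 := by omega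
    rw [Finset.card_eq_zero, Finset.filter_eq_empty_iff] at h0
    have := h0 ht
    simp only [OnB]
    omega
  obtain ⟨q, q1, q2, q3, q4, q5⟩ := hT.fill.step (c := 0) (h := 0) (w := 19) (by omega) (by omega)
    (by omega) (fun i hi => by omega) (fun i _ hi => hgt_cons_lt (by omega))
    (by rw [hgt_cons_ge (by omega)]; simp [hgt])
  have hq18 : q ≤ 18 := (hT.1 _ q4).2.1
  have hF := q5 (hgt (.cons q q (.cons (19 - q) 0 .nil))) (by
    intro i
    simp only [hgt]
    split_ifs <;> omega)
  have hfe : ((T.erase (0, 0, q)).filter (fun t => t.2.1 = 0)).card + 1 = nB T := by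
    rw [Finset.filter_erase]
    exact Finset.card_erase_add_one (Finset.mem_filter.2 ⟨q4, rfl⟩)
  have hce : (T.erase (0, 0, q)).card ≤ 11 := by
    rw [Finset.card_erase_of_mem q4]; omega
  have hbt : bottom q 3 11 (.cons q q (.cons (19 - q) 0 .nil)) = true := by
    clear hF hfe hce q5 q4
    interval_cases q
    · exact t1
    · exact t2
    · exact t3
    · exact t4
    · exact t5
    · exact t6
    · exact t7
    · exact t8
    · exact t9
    · exact t10
    · exact t11
    · exact t12
    · exact t13
    · exact t14
    · exact t15
    · exact t16
    · exact t17
    · exact t18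
  exact bottom_sound q 3 11 _ _ hbt ⟨q1, by omega, trivial⟩ (by simp only [tot]; omega) hF hce
    (by omega) (fun h t ht => hbd (by omega) t (Finset.mem_of_mem_erase ht))
    (fun t ht h1 h2 => hbal _ q4 t (Finset.mem_of_mem_erase ht) rfl rfl h1 h2)

theorem lower_s15 {T} (hT : Til T) : 13 ≤ T.card := by
  by_contra hlt
  have hex : ∃ n, ∃ T', Til T' ∧ T'.card ≤ 12 ∧ nB T' = n := ⟨_, T, hT, by omega, rfl⟩
  classical
  obtain ⟨S, hS, hS2, hS3⟩ := Nat.find_spec hex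
  have hmin : ∀ T', Til T' → T'.card ≤ 12 → nB S ≤ nB T' := by
    intro T' h1 h2
    rw [hS3]
    exact Nat.find_min' hex ⟨T', h1, h2, rfl⟩
  rcases bal_or hS with hb | hb
  · exact core hS hS2 hmin hb
  · refine core (til_fl hS) ?_ ?_ hb
    · rw [Finset.card_image_of_injOn (fl_inj hS)]; exact hS2
    · rw [nB_fl hS]; exact hmin

def T13 : Finset (ℕ × ℕ × ℕ) :=
  {(0, 0, 10), (10, 0, 9), (10, 9, 5), (15, 9, 4), (0, 10, 6), (6, 10, 4), (15, 13, 1),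
    (16, 13, 3), (6, 14, 5), (11, 14, 5), (0, 16, 3), (3, 16, 3), (16, 16, 3)}

theorem T13_cov : ∀ i < 19, ∀ j < 19, (T13.filter (fun t => t.1 ≤ i ∧ i < t.1 + t.2.2 ∧
    t.2.1 ≤ j ∧ j < t.2.1 + t.2.2)).card = 1 := by decide +kernel

theorem T13_til : IsSquaredTiling 19 T13 := by
  refine ⟨by decide +kernel, ?_⟩
  intro i j hi hj
  obtain ⟨t, ht⟩ := Finset.card_eq_one.1 (T13_cov i hi j hj)
  refine ⟨t, ?_, ?_⟩
  · have : t ∈ ({t} : Finset (ℕ × ℕ × ℕ)) := Finset.mem_singleton_self t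
    rw [← ht] at this
    exact Finset.mem_filter.1 this
  · intro u hu
    have : u ∈ ({t} : Finset (ℕ × ℕ × ℕ)) := by
      rw [← ht]
      exact Finset.mem_filter.2 hu
    exact Finset.mem_singleton.1 this

theorem s_19 : s 19 = 13 := by
  unfold s
  have hmem : (13 : ℕ) ∈ {k | ∃ T : Finset (ℕ × ℕ × ℕ), IsSquaredTiling 19 T ∧ T.card = k} :=
    ⟨T13, T13_til, by decide +kernel⟩
  refine le_antisymm (Nat.sInf_le hmem) ?_
  obtain ⟨T, hT, hc⟩ := Nat.sInf_mem ⟨13, hmem⟩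
  rw [← hc]
  exact lower_s15 hT
end
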